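/- arXiv:2601.03853 — 2 statements merged into one kernel-verified Lean document; each statement's English description precedes it below -/
import Mathlib

section
/- Fix an integer K ≥ 1. Let φ : [0,1] → ℝ be nondecreasing and left-continuous, let x_1 ≤ x_2 ≤ … ≤ x_{K+1} be real numbers, and let p_1,…,p_{K+1} be arbitrary real numbers. On the standard simplex Δ := {π ∈ ℝ^{K+1} : π_k ≥ 0, Σ_{k=1}^{K+1} π_k = 1} with partial sums Π_0(π) := 0, Π_j(π) := Σ_{ℓ=1}^{j} π_ℓ, define Q(π) := Σ_{j=1}^{K+1} ∫_{Π_{j−1}(π)}^{Π_j(π)} (x_j·φ(z) − p_j) dz and the vector G(π) ∈ ℝ^{K+1} with entries G_k(π) := Σ_{j=k}^{K} (x_j − x_{j+1})·φ(Π_j(π)) + x_{K+1} − p_k. Then G(π) is a supergradient of Q at every π ∈ Δ: for all π, π' ∈ Δ, Q(π') ≤ Q(π) + Σ_{k=1}^{K+1} G_k(π)·(π'_k − π_k). -/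
open MeasureTheory

/-- The quantile utility `Q(π) = Σ_{j=0}^{K} ∫_{Π_j}^{Π_{j+1}} (x_j·φ(z) − p_j) dz`
of a quantile strategy `π` (indexed `π 0,…,π K`, with partial sums `Π_j = Σ_{ℓ<j} π ℓ`). -/
noncomputable def Qfun (K : ℕ) (φ : ℝ → ℝ) (x p : ℕ → ℝ) (π : ℕ → ℝ) : ℝ :=
  ∑ j ∈ Finset.range (K + 1),
    ∫ z in (∑ ℓ ∈ Finset.range j, π ℓ)..(∑ ℓ ∈ Finset.range (j + 1), π ℓ),
      (x j * φ z - p j)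

/-- The gradient vector of the quantile utility: with `0`-based index `k ∈ {0,…,K}`
(paper index `k+1`), `G_k(π) = Σ_{j=k+1}^{K} (x_{j-1} − x_j)·φ(Π_j) + x_K − p_k`
(in the paper's 1-based notation, `G_k = Σ_{j=k}^{K}(x_j − x_{j+1})φ(Π_j) + x_{K+1} − p_k`). -/
noncomputable def Gvec (K : ℕ) (φ : ℝ → ℝ) (x p : ℕ → ℝ) (π : ℕ → ℝ) (k : ℕ) : ℝ :=
  (∑ j ∈ Finset.Icc (k + 1) K,
      (x (j - 1) - x j) * φ (∑ ℓ ∈ Finset.range j, π ℓ)) + x K - p k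

/-- A monotone integrand has a convex primitive: the value at the base point is a subgradient. -/
theorem MonotoneOn.mul_sub_le_intervalIntegral {φ : ℝ → ℝ} {u : Set ℝ} [u.OrdConnected]
    (hφ : MonotoneOn φ u) {s t : ℝ} (hs : s ∈ u) (ht : t ∈ u) :
    φ s * (t - s) ≤ ∫ z in s..t, φ z := by
  have hint : IntervalIntegrable φ volume s t :=
    (hφ.mono (Set.OrdConnected.uIcc_subset ‹_› hs ht)).intervalIntegrable
  rcases le_total s t with h | h
  · have key := intervalIntegral.integral_mono_on h
      (intervalIntegrable_const (c := φ s)) hint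
      fun z hz => hφ hs (Set.OrdConnected.out ‹_› hs ht hz) hz.1
    simpa [mul_comm] using key
  · have key := intervalIntegral.integral_mono_on h hint.symm
      (intervalIntegrable_const (c := φ s))
      fun z hz => hφ (Set.OrdConnected.out ‹_› ht hs hz) hs hz.2
    rw [intervalIntegral.integral_symm]
    simp only [intervalIntegral.integral_const, smul_eq_mul] at key
    linarith

theorem sum_mul_succ_sub (x f : ℕ → ℝ) (n : ℕ) :
    ∑ j ∈ Finset.range (n + 1), x j * (f (j + 1) - f j) =
      x n * f (n + 1) - x 0 * f 0 + ∑ j ∈ Finset.range n, (x j - x (j + 1)) * f (j + 1) := by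
  induction n with
  | zero => simp; ring
  | succ n ih => rw [Finset.sum_range_succ, ih, Finset.sum_range_succ _ n]; ring

theorem sum_sum_Icc_mul (c d : ℕ → ℝ) (n : ℕ) :
    ∑ k ∈ Finset.range (n + 1), (∑ j ∈ Finset.Icc (k + 1) n, c j) * d k =
      ∑ j ∈ Finset.range n, c (j + 1) * ∑ k ∈ Finset.range (j + 1), d k := by
  induction n with
  | zero => simp
  | succ n ih =>
    have h : ∀ k ∈ Finset.range (n + 1), (∑ j ∈ Finset.Icc (k + 1) (n + 1), c j) * d k =
        (∑ j ∈ Finset.Icc (k + 1) n, c j) * d k + c (n + 1) * d k := fun k hk => by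
      rw [Finset.sum_Icc_succ_top (by have := Finset.mem_range.1 hk; omega)]; ring
    rw [Finset.sum_range_succ, Finset.sum_congr rfl h, Finset.sum_add_distrib, ih,
      ← Finset.mul_sum, Finset.sum_range_succ (fun j => c (j + 1) * _) n]
    simp

theorem partial_sum_mem_Icc {n j : ℕ} {π : ℕ → ℝ} (h0 : ∀ k < n, 0 ≤ π k)
    (h1 : ∑ k ∈ Finset.range n, π k = 1) (hj : j ≤ n) :
    ∑ k ∈ Finset.range j, π k ∈ Set.Icc (0 : ℝ) 1 :=
  ⟨Finset.sum_nonneg fun k hk => h0 k ((Finset.mem_range.1 hk).trans_le hj),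
    h1 ▸ Finset.sum_le_sum_of_subset_of_nonneg (Finset.range_mono hj)
      fun k hk _ => h0 k (Finset.mem_range.1 hk)⟩

/-- Summation by parts for the quantile utility on the simplex. -/
theorem Qfun_eq {K : ℕ} {φ : ℝ → ℝ} (hφ : MonotoneOn φ (Set.Icc 0 1)) (x p : ℕ → ℝ)
    {π : ℕ → ℝ} (h0 : ∀ k < K + 1, 0 ≤ π k) (h1 : ∑ k ∈ Finset.range (K + 1), π k = 1) :
    Qfun K φ x p π = x K * (∫ z in (0 : ℝ)..1, φ z)
      + ∑ j ∈ Finset.range K,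
          (x j - x (j + 1)) * (∫ z in (0 : ℝ)..(∑ l ∈ Finset.range (j + 1), π l), φ z)
      - ∑ k ∈ Finset.range (K + 1), p k * π k := by
  have hint : ∀ a ∈ Set.Icc (0 : ℝ) 1, ∀ b ∈ Set.Icc (0 : ℝ) 1,
      IntervalIntegrable φ volume a b := fun a ha b hb =>
    (hφ.mono (Set.OrdConnected.uIcc_subset Set.ordConnected_Icc ha hb)).intervalIntegrable
  have hz : (0 : ℝ) ∈ Set.Icc (0 : ℝ) 1 := by simp
  have hterm : ∀ j ∈ Finset.range (K + 1),
      (∫ z in (∑ l ∈ Finset.range j, π l)..(∑ l ∈ Finset.range (j + 1), π l),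
        (x j * φ z - p j)) =
      x j * ((∫ z in (0 : ℝ)..(∑ l ∈ Finset.range (j + 1), π l), φ z)
        - ∫ z in (0 : ℝ)..(∑ l ∈ Finset.range j, π l), φ z) - p j * π j := by
    intro j hj
    have hj' := Finset.mem_range.1 hj
    have ha := partial_sum_mem_Icc h0 h1 hj'.le
    have hb := partial_sum_mem_Icc h0 h1 (show j + 1 ≤ K + 1 by omega)
    rw [intervalIntegral.integral_sub ((hint _ ha _ hb).const_mul _) intervalIntegrable_const,
      intervalIntegral.integral_const_mul, intervalIntegral.integral_const,
      intervalIntegral.integral_interval_sub_left (hint _ hz _ hb) (hint _ hz _ ha),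
      Finset.sum_range_succ _ j, add_sub_cancel_left, smul_eq_mul, mul_comm (π j)]
  rw [Qfun, Finset.sum_congr rfl hterm, Finset.sum_sub_distrib,
    sum_mul_succ_sub x (fun j => ∫ z in (0 : ℝ)..(∑ l ∈ Finset.range j, π l), φ z), h1]
  simp

/-- **supergradient of the quantile utility.** If `φ : [0,1] → ℝ` is
nondecreasing and left-continuous and `x 0 ≤ … ≤ x K`, then `G(π)` is a supergradient of
`Q` at every point of the simplex: `Q(π') ≤ Q(π) + ⟨G(π), π' − π⟩` for all `π, π' ∈ Δ`. -/
theorem quantile_utility_supergradient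
    (K : ℕ) (hK : 1 ≤ K)
    (φ : ℝ → ℝ) (hφ : MonotoneOn φ (Set.Icc 0 1))
    (hφlc : ∀ q ∈ Set.Ioc (0 : ℝ) 1, ContinuousWithinAt φ (Set.Iio q) q)
    (x p : ℕ → ℝ) (hx : ∀ j < K, x j ≤ x (j + 1))
    (π π' : ℕ → ℝ)
    (hπ0 : ∀ k < K + 1, 0 ≤ π k) (hπ1 : ∑ k ∈ Finset.range (K + 1), π k = 1)
    (hπ'0 : ∀ k < K + 1, 0 ≤ π' k) (hπ'1 : ∑ k ∈ Finset.range (K + 1), π' k = 1) :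
    Qfun K φ x p π' ≤ Qfun K φ x p π
      + ∑ k ∈ Finset.range (K + 1), Gvec K φ x p π k * (π' k - π k) := by
  have hG : ∑ k ∈ Finset.range (K + 1), Gvec K φ x p π k * (π' k - π k) =
      ∑ j ∈ Finset.range K, (x j - x (j + 1)) * φ (∑ l ∈ Finset.range (j + 1), π l)
          * (∑ l ∈ Finset.range (j + 1), π' l - ∑ l ∈ Finset.range (j + 1), π l)
        - (∑ k ∈ Finset.range (K + 1), p k * π' k
          - ∑ k ∈ Finset.range (K + 1), p k * π k) := by
    simp only [Gvec, sub_mul _ (p _), add_mul, Finset.sum_sub_distrib, Finset.sum_add_distrib,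
      sum_sum_Icc_mul (fun j => (x (j - 1) - x j) * φ (∑ l ∈ Finset.range j, π l)),
      ← Finset.mul_sum, mul_sub (p _), hπ1, hπ'1]
    simp
  have hterm : ∑ j ∈ Finset.range K,
        (x j - x (j + 1)) * (∫ z in (0 : ℝ)..(∑ l ∈ Finset.range (j + 1), π' l), φ z) ≤
      ∑ j ∈ Finset.range K,
        (x j - x (j + 1)) * (∫ z in (0 : ℝ)..(∑ l ∈ Finset.range (j + 1), π l), φ z)
      + ∑ j ∈ Finset.range K, (x j - x (j + 1)) * φ (∑ l ∈ Finset.range (j + 1), π l)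
          * (∑ l ∈ Finset.range (j + 1), π' l - ∑ l ∈ Finset.range (j + 1), π l) := by
    rw [← Finset.sum_add_distrib]
    refine Finset.sum_le_sum fun j hj => ?_
    have hj' := Finset.mem_range.1 hj
    have ha := partial_sum_mem_Icc hπ0 hπ1 (show j + 1 ≤ K + 1 by omega)
    have hb := partial_sum_mem_Icc hπ'0 hπ'1 (show j + 1 ≤ K + 1 by omega)
    have hz : (0 : ℝ) ∈ Set.Icc (0 : ℝ) 1 := by simp
    have hint : ∀ b ∈ Set.Icc (0 : ℝ) 1, IntervalIntegrable φ volume 0 b := fun b hb =>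
      (hφ.mono (Set.OrdConnected.uIcc_subset Set.ordConnected_Icc hz hb)).intervalIntegrable
    have key := hφ.mul_sub_le_intervalIntegral ha hb
    rw [← intervalIntegral.integral_interval_sub_left (hint _ hb) (hint _ ha)] at key
    linarith [mul_le_mul_of_nonpos_left key (sub_nonpos.2 (hx j hj'))]
  rw [Qfun_eq hφ x p hπ0 hπ1, Qfun_eq hφ x p hπ'0 hπ'1, hG]
  linarith
end

section
/- Fix an integer K ≥ 1 and let B := {j/K : j = 0,1,…,K}. Let μ be a Borel probability measure on [0,1] with continuous CDF F(v) := μ([0,v]) and quantile function φ(q) := inf{v ∈ [0,1] : F(v) ≥ q}. Let X : B → [0,1] be nondecreasing and P : B → [0,1] satisfy P(0) = 0; write x_j := X((j−1)/K) and p_j := P((j−1)/K). Let π be in the standard simplex Δ ⊂ ℝ^{K+1} with Π_j(π) := Σ_{ℓ=1}^{j} π_ℓ (Π_0(π) := 0), let s_π : [0,1] → B be the quantile bidding strategy (s_π(v) := 0 for v ∈ [0, φ(Π_1(π))], s_π(v) := (j−1)/K for v ∈ (φ(Π_{j−1}(π)), φ(Π_j(π))] for 2 ≤ j ≤ K+1,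 s_π(v) := 1 for v > φ(1)), let x̃(v) := X(s_π(v)) and p̃(v) := x̃(v)·v − ∫_0^v x̃(z) dz, and define G(π) ∈ ℝ^{K+1} by G_k(π) := Σ_{j=k}^{K} (x_j − x_{j+1})·φ(Π_j(π)) + x_{K+1} − p_k. Then, with e := (1,0,…,0) ∈ ℝ^{K+1}: Σ_{k=1}^{K+1} G_k(π)·(e_k − π_k) = ∫_{[0,1]} P(s_π(v)) dμ(v) − ∫_{[0,1]} p̃(v) dμ(v). -/
open MeasureTheory

/-- The CDF `F(v) = μ([0,v])` of a measure on `[0,1]`. -/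
noncomputable def cdf (μ : Measure ℝ) (v : ℝ) : ℝ := (μ (Set.Icc 0 v)).toReal

/-- The quantile function `φ(q) = inf {v ∈ [0,1] : F(v) ≥ q}`. -/
noncomputable def quant (μ : Measure ℝ) (q : ℝ) : ℝ :=
  sInf {v : ℝ | v ∈ Set.Icc (0 : ℝ) 1 ∧ q ≤ cdf μ v}

/-- The gradient of the quantile utility function, with 0-based index `k ∈ {0,…,K}`
(paper index `k+1`):
`G_k(π) = Σ_{j=k+1}^{K} (X((j−1)/K) − X(j/K))·φ(Π_j) + X(K/K) − P(k/K)`. -/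
noncomputable def Gq (K : ℕ) (μ : Measure ℝ) (X P : ℝ → ℝ) (π : ℕ → ℝ) (k : ℕ) : ℝ :=
  (∑ j ∈ Finset.Icc (k + 1) K,
      (X (((j : ℝ) - 1) / K) - X ((j : ℝ) / K)) *
        quant μ (∑ ℓ ∈ Finset.range j, π ℓ))
    + X ((K : ℝ) / K) - P ((k : ℝ) / K)

lemma cdf_mono (μ : Measure ℝ) [IsFiniteMeasure μ] : Monotone (cdf μ) := fun _ _ h =>
  ENNReal.toReal_mono (measure_ne_top _ _) (measure_mono (Set.Icc_subset_Icc_right h))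

lemma cdf_one (μ : Measure ℝ) (hμ : μ (Set.Icc (0 : ℝ) 1) = 1) : cdf μ 1 = 1 := by
  simp [cdf, hμ]

lemma quant_mono (μ : Measure ℝ) (hμ : μ (Set.Icc (0 : ℝ) 1) = 1) {q r : ℝ} (hqr : q ≤ r)
    (hr : r ≤ 1) : quant μ q ≤ quant μ r :=
  csInf_le_csInf ⟨0, fun _ hv => hv.1.1⟩ ⟨1, ⟨zero_le_one, le_rfl⟩, by rwa [cdf_one μ hμ]⟩
    fun _ hv => ⟨hv.1, hqr.trans hv.2⟩

lemma quant_nonneg (μ : Measure ℝ) (q : ℝ) : 0 ≤ quant μ q :=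
  Real.sInf_nonneg fun _ hv => hv.1.1

lemma cdf_quant (μ : Measure ℝ) [IsFiniteMeasure μ] (hμ : μ (Set.Icc (0 : ℝ) 1) = 1)
    (hFcont : ContinuousOn (cdf μ) (Set.Icc 0 1)) (hF0 : cdf μ 0 = 0) {q : ℝ}
    (hq0 : 0 ≤ q) (hq1 : q ≤ 1) : cdf μ (quant μ q) = q := by
  have hbdd : BddBelow {v : ℝ | v ∈ Set.Icc (0 : ℝ) 1 ∧ q ≤ cdf μ v} := ⟨0, fun _ hv => hv.1.1⟩
  apply le_antisymm
  · obtain ⟨w, hw, hwq⟩ := intermediate_value_Icc zero_le_one hFcont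
      (show q ∈ Set.Icc (cdf μ 0) (cdf μ 1) by rw [hF0, cdf_one μ hμ]; exact ⟨hq0, hq1⟩)
    exact (cdf_mono μ (csInf_le hbdd ⟨hw, hwq.ge⟩)).trans_eq hwq
  · have hclosed : IsClosed {v : ℝ | v ∈ Set.Icc (0 : ℝ) 1 ∧ q ≤ cdf μ v} :=
      hFcont.preimage_isClosed_of_isClosed isClosed_Icc isClosed_Ici
    exact (hclosed.csInf_mem ⟨1, ⟨zero_le_one, le_rfl⟩, by rwa [cdf_one μ hμ]⟩ hbdd).2

/-- The mass of `[0,1]` strictly above the `q`-quantile is `1 - q`. -/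
lemma setIntegral_indicator_quant (μ : Measure ℝ) [IsFiniteMeasure μ]
    (hμ : μ (Set.Icc (0 : ℝ) 1) = 1)
    (hFcont : ContinuousOn (cdf μ) (Set.Icc 0 1)) (hF0 : cdf μ 0 = 0) {q : ℝ}
    (hq0 : 0 ≤ q) (hq1 : q ≤ 1) :
    ∫ v in Set.Icc (0 : ℝ) 1, (Set.Ioi (quant μ q)).indicator 1 v ∂μ = 1 - q := by
  have hle : quant μ q ≤ 1 :=
    csInf_le ⟨0, fun _ hv => hv.1.1⟩ ⟨⟨zero_le_one, le_rfl⟩, by rwa [cdf_one μ hμ]⟩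
  have hset : Set.Ioi (quant μ q) ∩ Set.Icc 0 1 = Set.Icc 0 1 \ Set.Icc 0 (quant μ q) := by
    ext v
    simp only [Set.mem_inter_iff, Set.mem_Ioi, Set.mem_Icc, Set.mem_sdiff, not_and, not_le]
    exact ⟨fun h => ⟨h.2, fun _ => h.1⟩, fun h => ⟨h.2 h.1.1, h.1⟩⟩
  rw [integral_indicator_one measurableSet_Ioi, measureReal_restrict_apply measurableSet_Ioi, hset,
    measureReal_sdiff (Set.Icc_subset_Icc_right hle) measurableSet_Icc]
  have h1 : μ.real (Set.Icc 0 1) = 1 := cdf_one μ hμ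
  have h2 : μ.real (Set.Icc 0 (quant μ q)) = q := cdf_quant μ hμ hFcont hF0 hq0 hq1
  rw [h1, h2]

lemma intervalIntegrable_indicator_Ioi (t a b : ℝ) :
    IntervalIntegrable ((Set.Ioi t).indicator (1 : ℝ → ℝ)) volume a b :=
  ⟨(integrable_const _).indicator measurableSet_Ioi,
    (integrable_const _).indicator measurableSet_Ioi⟩

lemma intervalIntegral_indicator_Ioi {t v : ℝ} (ht : 0 ≤ t) :
    ∫ z in (0 : ℝ)..v, (Set.Ioi t).indicator (1 : ℝ → ℝ) z
      = (Set.Ioi t).indicator (1 : ℝ → ℝ) v * (v - t) := by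
  rcases lt_or_ge t v with h | h
  · rw [← intervalIntegral.integral_add_adjacent_intervals
      (intervalIntegrable_indicator_Ioi t 0 t) (intervalIntegrable_indicator_Ioi t t v),
      intervalIntegral.integral_congr (g := fun _ => (0 : ℝ)) fun z hz =>
        Set.indicator_of_notMem (by rw [Set.uIcc_of_le ht] at hz; exact not_lt.2 hz.2) _,
      intervalIntegral.integral_of_le h.le,
      setIntegral_congr_fun (g := fun _ => (1 : ℝ)) measurableSet_Ioc fun z hz =>
        Set.indicator_of_mem (show z ∈ Set.Ioi t from hz.1) _,
      Set.indicator_of_mem (show v ∈ Set.Ioi t from h)]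
    simp [h.le]
  · rw [intervalIntegral.integral_congr (g := fun _ => (0 : ℝ)) fun z hz =>
        Set.indicator_of_notMem (show z ∉ Set.Ioi t from not_lt.2 (hz.2.trans (max_le ht h))) _,
      Set.indicator_of_notMem (show v ∉ Set.Ioi t from not_lt.2 h)]
    simp

/-- A function of a step function is a combination of indicators of the rays above its jumps. -/
lemma comp_step_eq_sum (f s : ℝ → ℝ) (K : ℕ) (hK : 1 ≤ K) (t : ℕ → ℝ)
    (ht : ∀ i j, i ≤ j → j ≤ K → t i ≤ t j)
    {v : ℝ} (hs0 : v ≤ t 1 → s v = 0)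
    (hsj : ∀ j, 1 ≤ j → j < K → t j < v → v ≤ t (j + 1) → s v = (j : ℝ) / K)
    (hs1 : t K < v → s v = 1) :
    f (s v) = f 0 + ∑ j ∈ Finset.range K, (f (((j + 1 : ℕ) : ℝ) / K) - f ((j : ℝ) / K)) *
      (Set.Ioi (t (j + 1))).indicator 1 v := by
  obtain ⟨J, hJK, hsJ, hJ⟩ : ∃ J ≤ K, s v = (J : ℝ) / K ∧
      ∀ j < K, (t (j + 1) < v ↔ j < J) := by
    classical
    set J := Nat.findGreatest (fun j => t j < v) K with hJdef
    have hJK : J ≤ K := Nat.findGreatest_le K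
    have hlt : J ≠ 0 → t J < v := fun h => Nat.findGreatest_of_ne_zero hJdef.symm h
    have hge : ∀ j, J < j → j ≤ K → v ≤ t j := fun j h h' =>
      not_lt.1 (Nat.findGreatest_is_greatest h h')
    refine ⟨J, hJK, ?_, fun j hj => ⟨fun h => ?_, fun h => ?_⟩⟩
    · rcases Nat.eq_zero_or_pos J with h0 | hpos
      · rw [hs0 (hge 1 (by omega) hK), h0]; simp
      · rcases hJK.eq_or_lt with h | h
        · have hK0 : (K : ℝ) ≠ 0 := by positivity
          rw [h, div_self hK0]
          exact hs1 (h ▸ hlt hpos.ne')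
        · exact hsj J hpos h (hlt hpos.ne') (hge _ (Nat.lt_succ_self J) h)
    · by_contra hc
      exact absurd (hge (j + 1) (by omega) hj) (not_le.2 h)
    · exact (ht (j + 1) J h hJK).trans_lt (hlt (by omega))
  have hsum : ∑ j ∈ Finset.range K, (f (((j + 1 : ℕ) : ℝ) / K) - f ((j : ℝ) / K)) *
      (Set.Ioi (t (j + 1))).indicator 1 v
      = ∑ j ∈ Finset.range J, (f (((j + 1 : ℕ) : ℝ) / K) - f ((j : ℝ) / K)) := by
    rw [← Finset.sum_subset (Finset.range_mono hJK)]
    · refine Finset.sum_congr rfl fun j hj => ?_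
      have hj' := Finset.mem_range.1 hj
      rw [Set.indicator_of_mem (show v ∈ Set.Ioi _ from (hJ j (by omega)).2 hj')]
      simp
    · intro j hj hj'
      rw [Finset.mem_range] at hj hj'
      rw [Set.indicator_of_notMem (show v ∉ Set.Ioi _ from fun h => hj' ((hJ j hj).1 h)), mul_zero]
  rw [hsum, Finset.sum_range_sub (fun j : ℕ => f ((j : ℝ) / K)), hsJ]
  simp

/-- Summation by parts for the quantile gradient paired with `e - π`. -/
lemma sum_Gq_mul (K : ℕ) (μ : Measure ℝ) (X P : ℝ → ℝ) (π : ℕ → ℝ)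
    (hπ1 : ∑ k ∈ Finset.range (K + 1), π k = 1) :
    ∑ k ∈ Finset.range (K + 1),
        Gq K μ X P π k * ((if k = 0 then (1 : ℝ) else 0) - π k)
      = ∑ j ∈ Finset.range K, (P (((j + 1 : ℕ) : ℝ) / K) - P ((j : ℝ) / K)) *
          (1 - ∑ ℓ ∈ Finset.range (j + 1), π ℓ)
        - ∑ j ∈ Finset.range K, (X (((j + 1 : ℕ) : ℝ) / K) - X ((j : ℝ) / K)) *
          (quant μ (∑ ℓ ∈ Finset.range (j + 1), π ℓ) *
            (1 - ∑ ℓ ∈ Finset.range (j + 1), π ℓ)) := by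
  have abel : ∀ (a w : ℕ → ℝ) (n : ℕ), ∑ k ∈ Finset.range (n + 1), a k * w k =
      a n * ∑ k ∈ Finset.range (n + 1), w k -
        ∑ j ∈ Finset.range n, (a (j + 1) - a j) * ∑ k ∈ Finset.range (j + 1), w k := by
    intro a w n
    induction n with
    | zero => simp
    | succ n ih =>
      rw [Finset.sum_range_succ, ih, Finset.sum_range_succ w (n + 1),
        Finset.sum_range_succ (fun j => (a (j + 1) - a j) * ∑ k ∈ Finset.range (j + 1), w k) n]
      ring
  have hW : ∀ n, ∑ k ∈ Finset.range (n + 1), ((if k = 0 then (1 : ℝ) else 0) - π k) =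
      1 - ∑ k ∈ Finset.range (n + 1), π k := fun n => by
    rw [Finset.sum_sub_distrib]; simp
  rw [abel, hW K, hπ1, sub_self, mul_zero, zero_sub, ← Finset.sum_neg_distrib,
    ← Finset.sum_sub_distrib]
  refine Finset.sum_congr rfl fun j hj => ?_
  have hjK : j + 1 ≤ K := Finset.mem_range.1 hj
  rw [hW, Gq, Gq, ← Finset.add_sum_Ioc_eq_sum_Icc hjK, ← Finset.Icc_add_one_left_eq_Ioc]
  push_cast
  rw [add_sub_cancel_right]
  ring

/-- **single-bidder per-round identity.** Let `X : B → [0,1]` be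
nondecreasing, `P : B → [0,1]` with `P 0 = 0`, `π ∈ Δ`, `s = s_π` the quantile bidding
strategy (piecewise hypotheses), `x̃ = X ∘ s`, and `p̃` the Myerson payment of `x̃`.
Then `⟨G(π), e − π⟩ = ∫_{[0,1]} P(s v) dμ(v) − ∫_{[0,1]} p̃(v) dμ(v)`,
where `e = (1,0,…,0)`. -/
theorem per_round_identity_single_bidder
    (K : ℕ) (hK : 1 ≤ K)
    (μ : Measure ℝ) [IsProbabilityMeasure μ] (hμ : μ (Set.Icc (0 : ℝ) 1) = 1)
    (hFcont : ContinuousOn (cdf μ) (Set.Icc 0 1)) (hF0 : cdf μ 0 = 0)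
    (X P : ℝ → ℝ)
    (hX01 : ∀ j ≤ K, X ((j : ℝ) / K) ∈ Set.Icc (0 : ℝ) 1)
    (hXmono : ∀ j ≤ K, ∀ j' ≤ K, j ≤ j' → X ((j : ℝ) / K) ≤ X ((j' : ℝ) / K))
    (hP01 : ∀ j ≤ K, P ((j : ℝ) / K) ∈ Set.Icc (0 : ℝ) 1)
    (hP0 : P 0 = 0)
    (π : ℕ → ℝ) (hπ0 : ∀ k < K + 1, 0 ≤ π k)
    (hπ1 : ∑ k ∈ Finset.range (K + 1), π k = 1)
    (s : ℝ → ℝ)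
    (hs0 : ∀ v, 0 ≤ v → v ≤ quant μ (∑ ℓ ∈ Finset.range 1, π ℓ) → s v = 0)
    (hsj : ∀ j, 2 ≤ j → j ≤ K + 1 → ∀ v,
      quant μ (∑ ℓ ∈ Finset.range (j - 1), π ℓ) < v →
      v ≤ quant μ (∑ ℓ ∈ Finset.range j, π ℓ) → s v = ((j : ℝ) - 1) / K)
    (hs1 : ∀ v, quant μ 1 < v → s v = 1) :
    ∑ k ∈ Finset.range (K + 1),
        Gq K μ X P π k * ((if k = 0 then (1 : ℝ) else 0) - π k)
      = (∫ v in Set.Icc (0 : ℝ) 1, P (s v) ∂μ)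
        - ∫ v in Set.Icc (0 : ℝ) 1,
            (X (s v) * v - ∫ z in (0 : ℝ)..v, X (s z)) ∂μ := by
  set t : ℕ → ℝ := fun j => quant μ (∑ ℓ ∈ Finset.range j, π ℓ)
  have hS0 : ∀ j ≤ K + 1, 0 ≤ ∑ ℓ ∈ Finset.range j, π ℓ := fun j hj =>
    Finset.sum_nonneg fun k hk => hπ0 k (by have := Finset.mem_range.1 hk; omega)
  have hSmono : ∀ i j, i ≤ j → j ≤ K + 1 →
      ∑ ℓ ∈ Finset.range i, π ℓ ≤ ∑ ℓ ∈ Finset.range j, π ℓ := fun i j hij hj =>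
    Finset.sum_le_sum_of_subset_of_nonneg (Finset.range_mono hij)
      fun k hk _ => hπ0 k (by have := Finset.mem_range.1 hk; omega)
  have hS1 : ∀ j ≤ K + 1, ∑ ℓ ∈ Finset.range j, π ℓ ≤ 1 := fun j hj =>
    (hSmono j (K + 1) hj le_rfl).trans_eq hπ1
  have hK0 : (K : ℝ) ≠ 0 := by positivity
  have hstep : ∀ f : ℝ → ℝ, ∀ v, 0 ≤ v → f (s v) = f 0 + ∑ j ∈ Finset.range K,
      (f (((j + 1 : ℕ) : ℝ) / K) - f ((j : ℝ) / K)) *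
        (Set.Ioi (t (j + 1))).indicator 1 v := by
    intro f v hv
    refine comp_step_eq_sum f s K hK t
      (fun i j hij hj => quant_mono μ hμ (hSmono i j hij (by omega)) (hS1 j (by omega)))
      (hs0 v hv) (fun j hj hjK h h' => ?_) (fun h => ?_)
    · rw [hsj (j + 1) (by omega) (by omega) v h h']
      push_cast; ring
    · rcases le_or_gt v (quant μ 1) with h' | h'
      · rw [hsj (K + 1) (by omega) le_rfl v h (hπ1.symm ▸ h')]
        push_cast; field_simp; ring
      · exact hs1 v h'
  have hint : ∀ c t : ℝ, Integrable (fun v => c * (Set.Ioi t).indicator (1 : ℝ → ℝ) v)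
      (μ.restrict (Set.Icc 0 1)) := fun c t =>
    ((integrable_const (1 : ℝ)).indicator measurableSet_Ioi).const_mul c
  have hmass : ∀ j ∈ Finset.range K,
      ∫ v in Set.Icc (0 : ℝ) 1, (Set.Ioi (t (j + 1))).indicator 1 v ∂μ
        = 1 - ∑ ℓ ∈ Finset.range (j + 1), π ℓ := fun j hj => by
    have := Finset.mem_range.1 hj
    exact setIntegral_indicator_quant μ hμ hFcont hF0 (hS0 _ (by omega)) (hS1 _ (by omega))
  have hPint : ∫ v in Set.Icc (0 : ℝ) 1, P (s v) ∂μ =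
      ∑ j ∈ Finset.range K, (P (((j + 1 : ℕ) : ℝ) / K) - P ((j : ℝ) / K)) *
          (1 - ∑ ℓ ∈ Finset.range (j + 1), π ℓ) := by
    rw [setIntegral_congr_fun measurableSet_Icc fun v hv => (hstep P v hv.1).trans
      (by rw [hP0, zero_add]), integral_finsetSum _ fun j _ => hint _ _]
    exact Finset.sum_congr rfl fun j hj => by rw [integral_const_mul, hmass j hj]
  have hpay : ∀ v, 0 ≤ v → X (s v) * v - ∫ z in (0 : ℝ)..v, X (s z) =
      ∑ j ∈ Finset.range K, (X (((j + 1 : ℕ) : ℝ) / K) - X ((j : ℝ) / K)) * t (j + 1) *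
        (Set.Ioi (t (j + 1))).indicator 1 v := by
    intro v hv
    have hterm : ∀ j ∈ Finset.range K, IntervalIntegrable
        (fun z => (X (((j + 1 : ℕ) : ℝ) / K) - X ((j : ℝ) / K)) *
          (Set.Ioi (t (j + 1))).indicator 1 z) volume 0 v := fun j _ =>
      (intervalIntegrable_indicator_Ioi (t (j + 1)) 0 v).const_mul _
    rw [intervalIntegral.integral_congr (g := fun z => X 0 + ∑ j ∈ Finset.range K,
        (X (((j + 1 : ℕ) : ℝ) / K) - X ((j : ℝ) / K)) *
          (Set.Ioi (t (j + 1))).indicator 1 z)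
        (fun z hz => hstep X z (by rw [Set.uIcc_of_le hv] at hz; exact hz.1)),
      intervalIntegral.integral_add intervalIntegrable_const
        (by simpa only [Finset.sum_fn] using IntervalIntegrable.sum (Finset.range K) hterm),
      intervalIntegral.integral_finsetSum hterm,
      hstep X v hv]
    simp only [intervalIntegral.integral_const_mul,
      intervalIntegral_indicator_Ioi (quant_nonneg μ _), t, intervalIntegral.integral_const]
    rw [add_mul, Finset.sum_mul, add_sub_add_comm, ← Finset.sum_sub_distrib]
    simp only [smul_eq_mul, sub_zero, mul_comm v, sub_self, zero_add]
    exact Finset.sum_congr rfl fun j _ => by ring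
  have hpayint : ∫ v in Set.Icc (0 : ℝ) 1, (X (s v) * v - ∫ z in (0 : ℝ)..v, X (s z)) ∂μ =
      ∑ j ∈ Finset.range K, (X (((j + 1 : ℕ) : ℝ) / K) - X ((j : ℝ) / K)) *
          (t (j + 1) * (1 - ∑ ℓ ∈ Finset.range (j + 1), π ℓ)) := by
    rw [setIntegral_congr_fun measurableSet_Icc fun v hv => hpay v hv.1,
      integral_finsetSum _ fun j _ => hint _ _]
    exact Finset.sum_congr rfl fun j hj => by rw [integral_const_mul, hmass j hj, mul_assoc]
  rw [hPint, hpayint, sum_Gq_mul K μ X P π hπ1]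
end
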